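/- Rooted partial failure trace equivalence ≡^{r*}_FT is a congruence for the operators of CCSP_t: if P ≡^{r*}_FT P' and Q ≡^{r*}_FT Q', then α.P ≡^{r*}_FT α.P' (for every α ∈ Act), P+Q ≡^{r*}_FT P'+Q', P ∥_S Q ≡^{r*}_FT P' ∥_S Q' (for every S ⊆ A), τ_I(P) ≡^{r*}_FT τ_I(P') (for every I ⊆ A), and R(P) ≡^{r*}_FT R(P') (for every R ⊆ A×A with all sets {b | (a,b) ∈ R} finite). -/

import Mathlib

/-! ### The process algebra CCSP_t

The countably infinite set `A` of visible actions and the countably infinite set `V`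
of variables are both taken to be `ℕ`. -/

/-- Actions: visible actions from `A = ℕ`, the hidden action `τ`,
and the time-out action `t`. -/
inductive Act : Type
  | act : ℕ → Act
  | tau : Act
  | timeout : Act

/-- CCSP_t expressions.  A recursive specification `S` is represented as a partial
function `ℕ → Option Expr`; its domain is the set `V_S` of bound variables, and
`⟨X|S⟩` is written `Expr.fix X S`. -/
inductive Expr : Type
  | nil : Expr
  | pre : Act → Expr → Expr
  | choice : Expr → Expr → Expr
  | par : Set ℕ → Expr → Expr → Expr
  | abs : Set ℕ → Expr → Expr
  | ren : Set (ℕ × ℕ) → Expr → Expr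
  | var : ℕ → Expr
  | fix : ℕ → (ℕ → Option Expr) → Expr

/-- `α.notIn S`: the action `α` is not a visible action belonging to `S ⊆ A`. -/
def Act.notIn (α : Act) (S : Set ℕ) : Prop := ∀ a : ℕ, α = Act.act a → a ∉ S

/-- Relational substitution: `Subst ρ E E'` holds iff `E'` is the result of replacing,
in `E`, every free occurrence of each variable `Y` in the domain of `ρ` by the
expression `ρ Y` (occurrences bound by an inner recursion are not replaced). -/
inductive Subst : (ℕ → Option Expr) → Expr → Expr → Prop
  | nil {ρ} : Subst ρ .nil .nil
  | pre {ρ α E E'} : Subst ρ E E' → Subst ρ (.pre α E) (.pre α E')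
  | choice {ρ E F E' F'} : Subst ρ E E' → Subst ρ F F' →
      Subst ρ (.choice E F) (.choice E' F')
  | par {ρ S E F E' F'} : Subst ρ E E' → Subst ρ F F' →
      Subst ρ (.par S E F) (.par S E' F')
  | abs {ρ I E E'} : Subst ρ E E' → Subst ρ (.abs I E) (.abs I E')
  | ren {ρ R E E'} : Subst ρ E E' → Subst ρ (.ren R E) (.ren R E')
  | varNone {ρ Y} : ρ Y = none → Subst ρ (.var Y) (.var Y)
  | varSome {ρ Y F} : ρ Y = some F → Subst ρ (.var Y) F
  | fix {ρ Z} {T T' : ℕ → Option Expr} :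
      (∀ Y, T Y = none ↔ T' Y = none) →
      (∀ Y E E', T Y = some E → T' Y = some E' →
          Subst (fun W => if (T W).isSome then none else ρ W) E E') →
      Subst ρ (.fix Z T) (.fix Z T')

/-- The substitution replacing each bound variable `Y` of `S` by `⟨Y|S⟩`. -/
def recmap (S : ℕ → Option Expr) : ℕ → Option Expr :=
  fun Y => (S Y).map (fun _ => Expr.fix Y S)

/-- The structural operational (interleaving) semantics of CCSP_t. -/
inductive Step : Expr → Act → Expr → Prop
  | pre {α E} : Step (.pre α E) α E
  | choiceL {E F α E'} : Step E α E' → Step (.choice E F) α E'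
  | choiceR {E F α F'} : Step F α F' → Step (.choice E F) α F'
  | renTau {R E E'} : Step E .tau E' → Step (.ren R E) .tau (.ren R E')
  | renTimeout {R E E'} : Step E .timeout E' →
      Step (.ren R E) .timeout (.ren R E')
  | renAct {R E E' a b} : Step E (.act a) E' → (a, b) ∈ R →
      Step (.ren R E) (.act b) (.ren R E')
  | parL {S E F α E'} : Step E α E' → α.notIn S →
      Step (.par S E F) α (.par S E' F)
  | parR {S E F α F'} : Step F α F' → α.notIn S →
      Step (.par S E F) α (.par S E F')
  | parSync {S E F a E' F'} : Step E (.act a) E' → Step F (.act a) F' → a ∈ S →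
      Step (.par S E F) (.act a) (.par S E' F')
  | absFree {I E α E'} : Step E α E' → α.notIn I →
      Step (.abs I E) α (.abs I E')
  | absHide {I E a E'} : Step E (.act a) E' → a ∈ I →
      Step (.abs I E) .tau (.abs I E')
  | fixUnfold {X S E E' α F} : S X = some E → Subst (recmap S) E E' →
      Step E' α F → Step (.fix X S) α F

/-- Free occurrence of a variable in a CCSP_t expression. -/
inductive Free (x : ℕ) : Expr → Prop
  | pre {α E} : Free x E → Free x (.pre α E)
  | choiceL {E F} : Free x E → Free x (.choice E F)
  | choiceR {E F} : Free x F → Free x (.choice E F)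
  | parL {S E F} : Free x E → Free x (.par S E F)
  | parR {S E F} : Free x F → Free x (.par S E F)
  | abs {I E} : Free x E → Free x (.abs I E)
  | ren {R E} : Free x E → Free x (.ren R E)
  | var : Free x (.var x)
  | fix {Z T Y E} : T Y = some E → Free x E → T x = none → Free x (.fix Z T)

/-- An expression is closed if no variable occurs free in it. -/
def Closed (E : Expr) : Prop := ∀ x, ¬ Free x E

/-- Well-formedness: in every recursion `⟨X|S⟩` occurring in the expression the
variable `X` is bound by `S`, and every relational renaming occurring in it has
finite images `{b | (a,b) ∈ R}`. -/
inductive WF : Expr → Prop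
  | nil : WF .nil
  | pre {α E} : WF E → WF (.pre α E)
  | choice {E F} : WF E → WF F → WF (.choice E F)
  | par {S E F} : WF E → WF F → WF (.par S E F)
  | abs {I E} : WF E → WF (.abs I E)
  | ren {R E} : (∀ a : ℕ, {b | (a, b) ∈ R}.Finite) → WF E → WF (.ren R E)
  | var {X} : WF (.var X)
  | fix {X T} : (T X).isSome → (∀ Y E, T Y = some E → WF E) → WF (.fix X T)

/-- `ℙ`: a process is a closed well-formed CCSP_t expression. -/
def IsProcess (E : Expr) : Prop := Closed E ∧ WF E

/-- A process is stable if it has no outgoing τ-transitions. -/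
def stable (P : Expr) : Prop := ¬ ∃ P', Step P .tau P'

/-- The set `I(P)` of initial visible actions of a process. -/
def initials (P : Expr) : Set ℕ := {a | ∃ P', Step P (.act a) P'}

/-! ### Partial failure traces -/

/-- An element of a partial failure trace: a visible action `a ∈ A`
or a refusal set `X ⊆ A`. -/
abbrev Elt : Type := Sum ℕ (Set ℕ)

/-- Partial failure traces: sequences over `A ∪ 𝒫(A)`; the final tag `⊤` is
left implicit. -/
abbrev PFT : Type := List Elt

/-- The set of partial failure traces of a process (Table 3). -/
inductive fft : Expr → PFT → Prop
  | top {P} : fft P []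
  | act {P Q a ρ} : Step P (.act a) Q → fft Q ρ → fft P (Sum.inl a :: ρ)
  | tau {P Q ρ} : Step P .tau Q → fft Q ρ → fft P ρ
  | refusal {P X ρ} : (∀ a ∈ X, a ∉ initials P) → stable P → fft P ρ →
      fft P (Sum.inr X :: ρ)
  | timeoutRef {P Q X ρ} : (∀ a ∈ X, a ∉ initials P) → stable P →
      Step P .timeout Q → fft Q (Sum.inr X :: ρ) → fft P (Sum.inr X :: ρ)
  | timeoutAct {P Q X a ρ} : (∀ a' ∈ X, a' ∉ initials P) → stable P →
      Step P .timeout Q → fft Q (Sum.inl a :: ρ) → a ∈ X →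
      fft P (Sum.inr X :: Sum.inl a :: ρ)

def fftSet (P : Expr) : Set PFT := {σ | fft P σ}

/-! ### Rooted partial failure traces -/

/-- Rooted partial failure traces: ordinary partial failure traces, traces
`t·Xσ` starting with a time-out transition (represented as `rooted X σ`,
standing for the trace `Xσ` preceded by `t`), and the two tags `st`
and `post-st`. -/
inductive RPFT : Type
  | plain : PFT → RPFT
  | rooted : Set ℕ → PFT → RPFT
  | st : RPFT
  | postst : RPFT

/-- The set `rfft(P)` of rooted partial failure traces of a process. -/
def rfftSet (P : Expr) : Set RPFT :=
  {r |
    (∃ σ, r = RPFT.plain σ ∧ fft P σ) ∨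
    (r = RPFT.st ∧ stable P) ∨
    (∃ X σ, r = RPFT.rooted X σ ∧ stable P ∧ (∀ a ∈ X, a ∉ initials P) ∧
      ∃ P', Step P .timeout P' ∧ fft P' (Sum.inr X :: σ)) ∨
    (r = RPFT.postst ∧ (∃ P', Step P .tau P') ∧ fft P [Sum.inr (∅ : Set ℕ)])}

/-! ### Refusals and derived rules for partial failure traces -/

/-- A stable process refuses `X` if it has no initial action in `X`. -/
def Refuses (P : Expr) (X : Set ℕ) : Prop := stable P ∧ ∀ a ∈ X, a ∉ initials P

/-- The trace starts with a visible action belonging to `X`. -/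
def HeadIn (X : Set ℕ) (ρ : PFT) : Prop := ∃ a ρ', ρ = Sum.inl a :: ρ' ∧ a ∈ X

/-- `t·Xσ` is a rooted partial failure trace of `P`. -/
def RootedTrace (P : Expr) (X : Set ℕ) (σ : PFT) : Prop :=
  Refuses P X ∧ ∃ P', Step P .timeout P' ∧ fft P' (Sum.inr X :: σ)

theorem Refuses.mono {P : Expr} {X Y : Set ℕ} (h : Refuses P X) (hYX : Y ⊆ X) : Refuses P Y :=
  ⟨h.1, fun a ha => h.2 a (hYX ha)⟩

theorem Refuses.fft_cons {P : Expr} {X : Set ℕ} {ρ : PFT} (h : Refuses P X) (hρ : fft P ρ) :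
    fft P (Sum.inr X :: ρ) :=
  .refusal h.2 h.1 hρ

theorem Refuses.fft_cons_of_timeout {P P' : Expr} {X : Set ℕ} {ρ : PFT} (h : Refuses P X)
    (hs : Step P .timeout P') (hρ : fft P' (Sum.inr X :: ρ)) : fft P (Sum.inr X :: ρ) :=
  .timeoutRef h.2 h.1 hs hρ

theorem Refuses.fft_cons_of_headIn {P P' : Expr} {X : Set ℕ} {ρ : PFT} (h : Refuses P X)
    (hs : Step P .timeout P') (hX : HeadIn X ρ) (hρ : fft P' ρ) : fft P (Sum.inr X :: ρ) := by
  obtain ⟨a, ρ', rfl, ha⟩ := hX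
  exact .timeoutAct h.2 h.1 hs hρ ha

/-- Induction on partial failure traces, in terms of `Refuses` and `HeadIn`. -/
theorem fft_induction {motive : Expr → PFT → Prop}
    (top : ∀ P, motive P [])
    (act : ∀ P P' a ρ, Step P (.act a) P' → fft P' ρ → motive P' ρ → motive P (Sum.inl a :: ρ))
    (tau : ∀ P P' ρ, Step P .tau P' → fft P' ρ → motive P' ρ → motive P ρ)
    (refusal : ∀ P X ρ, Refuses P X → fft P ρ → motive P ρ → motive P (Sum.inr X :: ρ))
    (timeoutRef : ∀ P P' X ρ, Refuses P X → Step P .timeout P' → fft P' (Sum.inr X :: ρ) →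
      motive P' (Sum.inr X :: ρ) → motive P (Sum.inr X :: ρ))
    (timeoutAct : ∀ P P' X ρ, Refuses P X → Step P .timeout P' → HeadIn X ρ → fft P' ρ →
      motive P' ρ → motive P (Sum.inr X :: ρ))
    {P : Expr} {σ : PFT} (h : fft P σ) : motive P σ := by
  induction h with
  | top => exact top _
  | act hs h ih => exact act _ _ _ _ hs h ih
  | tau hs h ih => exact tau _ _ _ hs h ih
  | refusal hX hst h ih => exact refusal _ _ _ ⟨hst, hX⟩ h ih
  | timeoutRef hX hst hs h ih => exact timeoutRef _ _ _ _ ⟨hst, hX⟩ hs h ih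
  | timeoutAct hX hst hs h ha ih =>
    exact timeoutAct _ _ _ _ ⟨hst, hX⟩ hs ⟨_, _, rfl, ha⟩ h ih

/-- Induction on the derivation of a trace starting with a refusal set. -/
theorem fft_inr_induction {X : Set ℕ} {ρ : PFT} {motive : Expr → Prop}
    (tau : ∀ P P', Step P .tau P' → motive P' → motive P)
    (refusal : ∀ P, Refuses P X → fft P ρ → motive P)
    (timeoutRef : ∀ P P', Refuses P X → Step P .timeout P' → motive P' → motive P)
    (timeoutAct : ∀ P P', Refuses P X → Step P .timeout P' → HeadIn X ρ → fft P' ρ → motive P)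
    {P : Expr} (h : fft P (Sum.inr X :: ρ)) : motive P := by
  suffices H : ∀ σ, fft P σ → σ = Sum.inr X :: ρ → motive P from H _ h rfl
  intro σ h
  refine fft_induction (motive := fun P σ => σ = Sum.inr X :: ρ → motive P)
    ?_ ?_ ?_ ?_ ?_ ?_ h
  · simp
  · simp
  · exact fun P P' ρ hs _ ih e => tau _ _ hs (ih e)
  · rintro P Y ρ' hY h - e
    cases e
    exact refusal _ hY h
  · rintro P P' Y ρ' hY hs - ih e
    cases e
    exact timeoutRef _ _ hY hs (ih rfl)
  · rintro P P' Y ρ' hY hs hh h - e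
    cases e
    exact timeoutAct _ _ hY hs hh h

/-- Induction on the derivation of a trace starting with a visible action. -/
theorem fft_inl_induction {a : ℕ} {ρ : PFT} {motive : Expr → Prop}
    (tau : ∀ P P', Step P .tau P' → motive P' → motive P)
    (act : ∀ P P', Step P (.act a) P' → fft P' ρ → motive P)
    {P : Expr} (h : fft P (Sum.inl a :: ρ)) : motive P := by
  suffices H : ∀ σ, fft P σ → σ = Sum.inl a :: ρ → motive P from H _ h rfl
  intro σ h
  refine fft_induction (motive := fun P σ => σ = Sum.inl a :: ρ → motive P)
    ?_ ?_ ?_ ?_ ?_ ?_ h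
  · simp
  · rintro P P' b ρ' hs h - e
    cases e
    exact act _ _ hs h
  · exact fun P P' ρ hs _ ih e => tau _ _ hs (ih e)
  · simp
  · simp
  · simp

theorem mem_initials_of_fft {P : Expr} {a : ℕ} {ρ : PFT} (hP : stable P)
    (h : fft P (Sum.inl a :: ρ)) : a ∈ initials P := by
  cases h with
  | act hs _ => exact ⟨_, hs⟩
  | tau hs _ => exact (hP ⟨_, hs⟩).elim

theorem mem_initials_iff {P : Expr} {a : ℕ} (hP : stable P) :
    a ∈ initials P ↔ fft P [Sum.inl a] :=
  ⟨fun ⟨_, hs⟩ => .act hs .top, mem_initials_of_fft hP⟩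

theorem Refuses.not_headIn {P : Expr} {X : Set ℕ} {ρ : PFT} (h : Refuses P X) (hρ : fft P ρ) :
    ¬ HeadIn X ρ := by
  rintro ⟨a, ρ', rfl, ha⟩
  exact h.2 a ha (mem_initials_of_fft h.1 hρ)

/-! ### Rooted equivalence without the redundant tag `post-st` -/

/-- Rooted partial failure trace equivalence, split into its components. -/
structure RootedEquiv (P Q : Expr) : Prop where
  fft_iff : ∀ σ, fft P σ ↔ fft Q σ
  stable_iff : stable P ↔ stable Q
  rooted_iff : ∀ X σ, RootedTrace P X σ ↔ RootedTrace Q X σ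

theorem plain_mem_rfftSet {P : Expr} {σ : PFT} : RPFT.plain σ ∈ rfftSet P ↔ fft P σ := by
  simp [rfftSet]

theorem st_mem_rfftSet {P : Expr} : RPFT.st ∈ rfftSet P ↔ stable P := by
  simp [rfftSet]

theorem rooted_mem_rfftSet {P : Expr} {X : Set ℕ} {σ : PFT} :
    RPFT.rooted X σ ∈ rfftSet P ↔ RootedTrace P X σ := by
  simp only [rfftSet, RootedTrace, Refuses, Set.mem_ofPred_eq]
  constructor
  · rintro (⟨_, h, _⟩ | ⟨h, _⟩ | ⟨X, σ, h, h1, h2, h3⟩ | ⟨h, _⟩)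
    · cases h
    · cases h
    · cases h
      exact ⟨⟨h1, h2⟩, h3⟩
    · cases h
  · rintro ⟨⟨h1, h2⟩, h3⟩
    exact .inr (.inr (.inl ⟨X, σ, rfl, h1, h2, h3⟩))

theorem postst_mem_rfftSet {P : Expr} :
    RPFT.postst ∈ rfftSet P ↔ ¬ stable P ∧ fft P [Sum.inr (∅ : Set ℕ)] := by
  simp [rfftSet, stable]

theorem rfftSet_eq_iff {P Q : Expr} : rfftSet P = rfftSet Q ↔ RootedEquiv P Q := by
  constructor
  · intro h
    refine ⟨fun σ => ?_, ?_, fun X σ => ?_⟩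
    · rw [← plain_mem_rfftSet, h, plain_mem_rfftSet]
    · rw [← st_mem_rfftSet, h, st_mem_rfftSet]
    · rw [← rooted_mem_rfftSet, h, rooted_mem_rfftSet]
  · intro h
    ext r
    cases r with
    | plain σ => rw [plain_mem_rfftSet, plain_mem_rfftSet, h.fft_iff]
    | rooted X σ => rw [rooted_mem_rfftSet, rooted_mem_rfftSet, h.rooted_iff]
    | st => rw [st_mem_rfftSet, st_mem_rfftSet, h.stable_iff]
    | postst => rw [postst_mem_rfftSet, postst_mem_rfftSet, h.fft_iff, h.stable_iff]

namespace RootedEquiv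

theorem symm {P Q : Expr} (h : RootedEquiv P Q) : RootedEquiv Q P :=
  ⟨fun σ => (h.fft_iff σ).symm, h.stable_iff.symm, fun X σ => (h.rooted_iff X σ).symm⟩

theorem initials_eq {P Q : Expr} (h : RootedEquiv P Q) (hP : stable P) :
    initials P = initials Q := by
  ext a
  rw [mem_initials_iff hP, mem_initials_iff (h.stable_iff.1 hP), h.fft_iff]

theorem refuses {P Q : Expr} {X : Set ℕ} (h : RootedEquiv P Q) (hP : Refuses P X) :
    Refuses Q X :=
  ⟨h.stable_iff.1 hP.1, h.initials_eq hP.1 ▸ hP.2⟩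

/-- A time-out followed by an action that was refused before is visible in the plain traces. -/
theorem exists_timeout {P P' Q : Expr} {X : Set ℕ} {ρ : PFT} (h : RootedEquiv P Q)
    (hP : Refuses P X) (hs : Step P .timeout P') (hX : HeadIn X ρ) (hρ : fft P' ρ) :
    ∃ Q', Step Q .timeout Q' ∧ (fft Q' ρ ∨ fft Q' (Sum.inr X :: ρ)) := by
  have hQ := h.refuses hP
  have hQρ := (h.fft_iff _).1 (hP.fft_cons_of_headIn hs hX hρ)
  cases hQρ with
  | tau hs' _ => exact (hQ.1 ⟨_, hs'⟩).elim
  | refusal _ _ h' => exact (hQ.not_headIn h' hX).elim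
  | timeoutRef _ _ hs' h' => exact ⟨_, hs', .inr h'⟩
  | timeoutAct _ _ hs' h' _ => exact ⟨_, hs', .inl h'⟩

end RootedEquiv

/-! ### Action prefix -/

theorem step_pre_iff {α β : Act} {P E : Expr} : Step (.pre α P) β E ↔ β = α ∧ E = P := by
  constructor
  · rintro ⟨⟩
    exact ⟨rfl, rfl⟩
  · rintro ⟨rfl, rfl⟩
    exact .pre

theorem stable_pre_iff {α : Act} {P : Expr} : stable (.pre α P) ↔ α ≠ .tau := by
  simp [stable, step_pre_iff, eq_comm]

theorem Refuses.pre_congr {α : Act} {P P' : Expr} {X : Set ℕ} (h : Refuses (.pre α P) X) :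
    Refuses (.pre α P') X := by
  simpa [Refuses, initials, step_pre_iff, stable_pre_iff] using h

theorem fft_pre_mono {α : Act} {P P' : Expr} (h : ∀ σ, fft P σ → fft P' σ) {σ : PFT}
    (hσ : fft (.pre α P) σ) : fft (.pre α P') σ := by
  suffices H : ∀ E, fft E σ → E = .pre α P → fft (.pre α P') σ from H _ hσ rfl
  intro E hE
  refine fft_induction (motive := fun E σ => E = .pre α P → fft (.pre α P') σ)
    ?_ ?_ ?_ ?_ ?_ ?_ hE
  · exact fun _ _ => .top
  · rintro _ E' a ρ hs hρ - rfl
    obtain ⟨rfl, rfl⟩ := step_pre_iff.1 hs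
    exact .act .pre (h _ hρ)
  · rintro _ E' ρ hs hρ - rfl
    obtain ⟨rfl, rfl⟩ := step_pre_iff.1 hs
    exact .tau .pre (h _ hρ)
  · rintro _ X ρ hX - ih rfl
    exact hX.pre_congr.fft_cons (ih rfl)
  · rintro _ E' X ρ hX hs hρ - rfl
    obtain ⟨rfl, rfl⟩ := step_pre_iff.1 hs
    exact hX.pre_congr.fft_cons_of_timeout .pre (h _ hρ)
  · rintro _ E' X ρ hX hs hh hρ - rfl
    obtain ⟨rfl, rfl⟩ := step_pre_iff.1 hs
    exact hX.pre_congr.fft_cons_of_headIn .pre hh (h _ hρ)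

theorem RootedTrace.pre_mono {α : Act} {P P' : Expr} (h : ∀ σ, fft P σ → fft P' σ)
    {X : Set ℕ} {σ : PFT} (hσ : RootedTrace (.pre α P) X σ) : RootedTrace (.pre α P') X σ := by
  obtain ⟨hX, E, hs, hE⟩ := hσ
  obtain ⟨rfl, rfl⟩ := step_pre_iff.1 hs
  exact ⟨hX.pre_congr, _, .pre, h _ hE⟩

theorem RootedEquiv.pre {P P' : Expr} (h : RootedEquiv P P') (α : Act) :
    RootedEquiv (.pre α P) (.pre α P') where
  fft_iff _ := ⟨fft_pre_mono fun σ => (h.fft_iff σ).1, fft_pre_mono fun σ => (h.fft_iff σ).2⟩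
  stable_iff := by rw [stable_pre_iff, stable_pre_iff]
  rooted_iff _ _ := ⟨RootedTrace.pre_mono fun σ => (h.fft_iff σ).1,
    RootedTrace.pre_mono fun σ => (h.fft_iff σ).2⟩

/-! ### Choice -/

theorem step_choice_iff {α : Act} {P Q E : Expr} :
    Step (.choice P Q) α E ↔ Step P α E ∨ Step Q α E := by
  constructor
  · rintro ⟨⟩
    · exact .inl ‹_›
    · exact .inr ‹_›
  · rintro (h | h)
    · exact .choiceL h
    · exact .choiceR h

theorem stable_choice_iff {P Q : Expr} : stable (.choice P Q) ↔ stable P ∧ stable Q := by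
  simp only [stable, step_choice_iff, exists_or, not_or]

theorem refuses_choice_iff {P Q : Expr} {X : Set ℕ} :
    Refuses (.choice P Q) X ↔ Refuses P X ∧ Refuses Q X := by
  simp only [Refuses, initials, Set.mem_ofPred_eq, stable_choice_iff, step_choice_iff, exists_or,
    not_or, imp_and, forall_and]
  tauto

theorem fft_inl_of_step {P E : Expr} (hE : ∀ α P', Step P α P' → Step E α P')
    {a : ℕ} {ρ : PFT} (h : fft P (Sum.inl a :: ρ)) : fft E (Sum.inl a :: ρ) := by
  cases h with
  | act hs h => exact .act (hE _ _ hs) h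
  | tau hs h => exact .tau (hE _ _ hs) h

theorem fft_of_step_of_not_stable {P E : Expr} (hE : ∀ α P', Step P α P' → Step E α P')
    (hP : ¬ stable P) {σ : PFT} (h : fft P σ) : fft E σ := by
  cases h with
  | top => exact .top
  | act hs h => exact .act (hE _ _ hs) h
  | tau hs h => exact .tau (hE _ _ hs) h
  | refusal _ hst => exact (hP hst).elim
  | timeoutRef _ hst => exact (hP hst).elim
  | timeoutAct _ hst => exact (hP hst).elim

theorem RootedEquiv.fft_choice {P P' Q Q' : Expr} (hP : RootedEquiv P P')
    (hQ : RootedEquiv Q Q') {σ : PFT} (hσ : fft (.choice P Q) σ) : fft (.choice P' Q') σ := by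
  have refuses {X : Set ℕ} (h : Refuses (.choice P Q) X) : Refuses (.choice P' Q') X :=
    have h := refuses_choice_iff.1 h
    refuses_choice_iff.2 ⟨hP.refuses h.1, hQ.refuses h.2⟩
  suffices H : ∀ E, fft E σ → E = .choice P Q → fft (.choice P' Q') σ from H _ hσ rfl
  intro E hE
  refine fft_induction (motive := fun E σ => E = .choice P Q → fft (.choice P' Q') σ)
    ?_ ?_ ?_ ?_ ?_ ?_ hE
  · exact fun _ _ => .top
  · rintro _ E' a ρ hs hρ - rfl
    obtain hs | hs := step_choice_iff.1 hs
    · exact fft_inl_of_step (fun _ _ => .choiceL) ((hP.fft_iff _).1 (.act hs hρ))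
    · exact fft_inl_of_step (fun _ _ => .choiceR) ((hQ.fft_iff _).1 (.act hs hρ))
  · rintro _ E' ρ hs hρ - rfl
    obtain hs | hs := step_choice_iff.1 hs
    · exact fft_of_step_of_not_stable (fun _ _ => .choiceL)
        (fun h => hP.stable_iff.2 h ⟨_, hs⟩) ((hP.fft_iff _).1 (.tau hs hρ))
    · exact fft_of_step_of_not_stable (fun _ _ => .choiceR)
        (fun h => hQ.stable_iff.2 h ⟨_, hs⟩) ((hQ.fft_iff _).1 (.tau hs hρ))
  · rintro _ X ρ hX - ih rfl
    exact (refuses hX).fft_cons (ih rfl)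
  · rintro _ E' X ρ hX hs hρ - rfl
    obtain hs | hs := step_choice_iff.1 hs
    · obtain ⟨-, E, hs', h⟩ := (hP.rooted_iff _ _).1 ⟨(refuses_choice_iff.1 hX).1, _, hs, hρ⟩
      exact (refuses hX).fft_cons_of_timeout (.choiceL hs') h
    · obtain ⟨-, E, hs', h⟩ := (hQ.rooted_iff _ _).1 ⟨(refuses_choice_iff.1 hX).2, _, hs, hρ⟩
      exact (refuses hX).fft_cons_of_timeout (.choiceR hs') h
  · rintro _ E' X ρ hX hs hh hρ - rfl
    obtain hs | hs := step_choice_iff.1 hs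
    · obtain ⟨E, hs', h | h⟩ := hP.exists_timeout (refuses_choice_iff.1 hX).1 hs hh hρ
      · exact (refuses hX).fft_cons_of_headIn (.choiceL hs') hh h
      · exact (refuses hX).fft_cons_of_timeout (.choiceL hs') h
    · obtain ⟨E, hs', h | h⟩ := hQ.exists_timeout (refuses_choice_iff.1 hX).2 hs hh hρ
      · exact (refuses hX).fft_cons_of_headIn (.choiceR hs') hh h
      · exact (refuses hX).fft_cons_of_timeout (.choiceR hs') h

theorem rootedTrace_choice_iff {P Q : Expr} {X : Set ℕ} {σ : PFT} :
    RootedTrace (.choice P Q) X σ ↔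
      (Refuses P X ∧ Refuses Q X) ∧ (RootedTrace P X σ ∨ RootedTrace Q X σ) := by
  simp only [RootedTrace, refuses_choice_iff, step_choice_iff, or_and_right, exists_or]
  exact and_congr_right fun ⟨h, h'⟩ => by simp only [h, h', true_and]

theorem RootedEquiv.choice {P P' Q Q' : Expr} (hP : RootedEquiv P P') (hQ : RootedEquiv Q Q') :
    RootedEquiv (.choice P Q) (.choice P' Q') where
  fft_iff _ := ⟨hP.fft_choice hQ, hP.symm.fft_choice hQ.symm⟩
  stable_iff := by rw [stable_choice_iff, stable_choice_iff, hP.stable_iff, hQ.stable_iff]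
  rooted_iff X σ := by
    rw [rootedTrace_choice_iff, rootedTrace_choice_iff, hP.rooted_iff, hQ.rooted_iff]
    exact and_congr_left fun _ => and_congr ⟨hP.refuses, hP.symm.refuses⟩
      ⟨hQ.refuses, hQ.symm.refuses⟩

/-! ### Remapping operators

Abstraction and renaming are both instances of an operator that replaces visible actions by
visible or hidden ones.  A label `none` stands for the hidden action `τ`. -/

/-- The operator `op` remaps visible actions according to `L`. -/
structure IsRemapping (op : Expr → Expr) (L : ℕ → Option ℕ → Prop) : Prop where
  step_tau_iff : ∀ P E, Step (op P) .tau E ↔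
    ∃ P', E = op P' ∧ (Step P .tau P' ∨ ∃ a, L a none ∧ Step P (.act a) P')
  step_timeout_iff : ∀ P E, Step (op P) .timeout E ↔ ∃ P', E = op P' ∧ Step P .timeout P'
  step_act_iff : ∀ P b E, Step (op P) (.act b) E ↔
    ∃ P', E = op P' ∧ ∃ a, Step P (.act a) P' ∧ L a (some b)

/-- The actions that may be remapped to `τ` or to an element of `X`. -/
def remapPreimage (L : ℕ → Option ℕ → Prop) (X : Set ℕ) : Set ℕ :=
  {a | L a none ∨ ∃ b ∈ X, L a (some b)}

/-- `RemapTrace L ρ σ`: a process with trace `ρ` has trace `σ` after remapping by `L`. -/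
inductive RemapTrace (L : ℕ → Option ℕ → Prop) : PFT → PFT → Prop
  | nil : RemapTrace L [] []
  | hide {a ρ σ} : L a none → RemapTrace L ρ σ → RemapTrace L (Sum.inl a :: ρ) σ
  | act {a b ρ σ} : L a (some b) → RemapTrace L ρ σ →
      RemapTrace L (Sum.inl a :: ρ) (Sum.inl b :: σ)
  | refusal {X ρ σ} : (HeadIn (remapPreimage L X) ρ → HeadIn X σ) → RemapTrace L ρ σ →
      RemapTrace L (Sum.inr (remapPreimage L X) :: ρ) (Sum.inr X :: σ)
  | merge {X ρ σ} : RemapTrace L ρ (Sum.inr X :: σ) →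
      RemapTrace L (Sum.inr (remapPreimage L X) :: ρ) (Sum.inr X :: σ)

theorem RemapTrace.head_of_inr {L : ℕ → Option ℕ → Prop} {X : Set ℕ} {ρ σ : PFT}
    (h : RemapTrace L ρ (Sum.inr X :: σ)) :
    (∃ ρ', ρ = Sum.inr (remapPreimage L X) :: ρ') ∨ HeadIn (remapPreimage L X) ρ := by
  cases h with
  | hide ha _ => exact .inr ⟨_, _, rfl, .inl ha⟩
  | refusal _ _ => exact .inl ⟨_, rfl⟩
  | merge _ => exact .inl ⟨_, rfl⟩

theorem RemapTrace.head_of_inl {L : ℕ → Option ℕ → Prop} {X : Set ℕ} {ρ σ : PFT}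
    (h : RemapTrace L ρ σ) (hσ : HeadIn X σ) : HeadIn (remapPreimage L X) ρ := by
  obtain ⟨a, σ, rfl, ha⟩ := hσ
  cases h with
  | hide h _ => exact ⟨_, _, rfl, .inl h⟩
  | act h _ => exact ⟨_, _, rfl, .inr ⟨_, ha, h⟩⟩

namespace IsRemapping

theorem stable_iff {op : Expr → Expr} {L : ℕ → Option ℕ → Prop} (hop : IsRemapping op L)
    {P : Expr} : stable (op P) ↔ Refuses P {a | L a none} := by
  constructor
  · intro h
    refine ⟨fun ⟨P', hs⟩ => h ⟨_, (hop.step_tau_iff _ _).2 ⟨P', rfl, .inl hs⟩⟩, ?_⟩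
    rintro a ha ⟨P', hs⟩
    exact h ⟨_, (hop.step_tau_iff _ _).2 ⟨P', rfl, .inr ⟨a, ha, hs⟩⟩⟩
  · rintro h ⟨E, hs⟩
    obtain ⟨P', -, hs | ⟨a, ha, hs⟩⟩ := (hop.step_tau_iff _ _).1 hs
    · exact h.1 ⟨_, hs⟩
    · exact h.2 a ha ⟨_, hs⟩

theorem refuses_iff {op : Expr → Expr} {L : ℕ → Option ℕ → Prop} (hop : IsRemapping op L)
    {P : Expr} {X : Set ℕ} : Refuses (op P) X ↔ Refuses P (remapPreimage L X) := by
  constructor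
  · intro h
    have hP := hop.stable_iff.1 h.1
    refine ⟨hP.1, ?_⟩
    rintro a (ha | ⟨b, hb, hab⟩)
    · exact hP.2 a ha
    · rintro ⟨P', hs⟩
      exact h.2 b hb ⟨_, (hop.step_act_iff _ _ _).2 ⟨P', rfl, a, hs, hab⟩⟩
  · intro h
    refine ⟨hop.stable_iff.2 (h.mono fun a => .inl), ?_⟩
    rintro b hb ⟨E, hs⟩
    obtain ⟨P', -, a, hs, hab⟩ := (hop.step_act_iff _ _ _).1 hs
    exact h.2 a (.inr ⟨b, hb, hab⟩) ⟨_, hs⟩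

theorem fft_of_remapTrace {op : Expr → Expr} {L : ℕ → Option ℕ → Prop}
    (hop : IsRemapping op L) {P : Expr} {ρ σ : PFT} (hρ : fft P ρ) (h : RemapTrace L ρ σ) :
    fft (op P) σ := by
  have timeout {P P' : Expr} (hs : Step P .timeout P') : Step (op P) .timeout (op P') :=
    (hop.step_timeout_iff _ _).2 ⟨_, rfl, hs⟩
  refine fft_induction (motive := fun P ρ => ∀ σ, RemapTrace L ρ σ → fft (op P) σ)
    ?_ ?_ ?_ ?_ ?_ ?_ hρ σ h
  · rintro P _ ⟨⟩
    exact .top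
  · intro P P' a ρ hs _ ih σ h
    cases h with
    | hide ha h => exact .tau ((hop.step_tau_iff _ _).2 ⟨_, rfl, .inr ⟨a, ha, hs⟩⟩) (ih _ h)
    | act ha h => exact .act ((hop.step_act_iff _ _ _).2 ⟨_, rfl, a, hs, ha⟩) (ih _ h)
  · exact fun P P' ρ hs _ ih σ h =>
      .tau ((hop.step_tau_iff _ _).2 ⟨_, rfl, .inl hs⟩) (ih _ h)
  · intro P X ρ hX _ ih σ h
    cases h with
    | refusal _ h => exact (hop.refuses_iff.2 hX).fft_cons (ih _ h)
    | merge h => exact ih _ h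
  · intro P P' X ρ hX hs _ ih σ h
    have h' := ih _ h
    cases h with
    | refusal _ _ => exact (hop.refuses_iff.2 hX).fft_cons_of_timeout (timeout hs) h'
    | merge _ => exact (hop.refuses_iff.2 hX).fft_cons_of_timeout (timeout hs) h'
  · intro P P' X ρ hX hs hh _ ih σ h
    cases h with
    | refusal hc h =>
      exact (hop.refuses_iff.2 hX).fft_cons_of_headIn (timeout hs) (hc hh) (ih _ h)
    | merge h => exact (hop.refuses_iff.2 hX).fft_cons_of_timeout (timeout hs) (ih _ h)

theorem exists_remapTrace {op : Expr → Expr} {L : ℕ → Option ℕ → Prop}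
    (hop : IsRemapping op L) {P : Expr} {σ : PFT} (hσ : fft (op P) σ) :
    ∃ ρ, RemapTrace L ρ σ ∧ fft P ρ := by
  refine fft_induction (motive := fun E σ => ∀ P, E = op P → ∃ ρ, RemapTrace L ρ σ ∧ fft P ρ)
    ?_ ?_ ?_ ?_ ?_ ?_ hσ P rfl
  · exact fun _ _ _ => ⟨[], .nil, .top⟩
  · rintro _ E b σ hs - ih P rfl
    obtain ⟨P', rfl, a, hs, ha⟩ := (hop.step_act_iff _ _ _).1 hs
    obtain ⟨ρ, h, hρ⟩ := ih _ rfl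
    exact ⟨_, .act ha h, .act hs hρ⟩
  · rintro _ E σ hs - ih P rfl
    obtain ⟨P', rfl, hs | ⟨a, ha, hs⟩⟩ := (hop.step_tau_iff _ _).1 hs
    · obtain ⟨ρ, h, hρ⟩ := ih _ rfl
      exact ⟨ρ, h, .tau hs hρ⟩
    · obtain ⟨ρ, h, hρ⟩ := ih _ rfl
      exact ⟨_, .hide ha h, .act hs hρ⟩
  · rintro _ X σ hX - ih P rfl
    obtain ⟨ρ, h, hρ⟩ := ih _ rfl
    have hP := hop.refuses_iff.1 hX
    exact ⟨_, .refusal (fun hh => (hP.not_headIn hρ hh).elim) h, hP.fft_cons hρ⟩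
  · rintro _ E X σ hX hs - ih P rfl
    obtain ⟨P', rfl, hs'⟩ := (hop.step_timeout_iff _ _).1 hs
    obtain ⟨ρ, h, hρ⟩ := ih _ rfl
    have hP := hop.refuses_iff.1 hX
    obtain ⟨ρ, rfl⟩ | hh := h.head_of_inr
    · exact ⟨_, h, hP.fft_cons_of_timeout hs' hρ⟩
    · exact ⟨_, .merge h, hP.fft_cons_of_headIn hs' hh hρ⟩
  · rintro _ E X σ hX hs hh - ih P rfl
    obtain ⟨P', rfl, hs'⟩ := (hop.step_timeout_iff _ _).1 hs
    obtain ⟨ρ, h, hρ⟩ := ih _ rfl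
    exact ⟨_, .refusal (fun _ => hh) h,
      (hop.refuses_iff.1 hX).fft_cons_of_headIn hs' (h.head_of_inl hh) hρ⟩

theorem fft_mono {op : Expr → Expr} {L : ℕ → Option ℕ → Prop} (hop : IsRemapping op L)
    {P P' : Expr} (h : ∀ σ, fft P σ → fft P' σ) {σ : PFT} (hσ : fft (op P) σ) :
    fft (op P') σ :=
  have ⟨_, hR, hρ⟩ := hop.exists_remapTrace hσ
  hop.fft_of_remapTrace (h _ hρ) hR

theorem rootedTrace {op : Expr → Expr} {L : ℕ → Option ℕ → Prop} (hop : IsRemapping op L)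
    {P Q : Expr} (h : RootedEquiv P Q) {X : Set ℕ} {σ : PFT} (hσ : RootedTrace (op P) X σ) :
    RootedTrace (op Q) X σ := by
  obtain ⟨hX, E, hs, hE⟩ := hσ
  have hP := hop.refuses_iff.1 hX
  refine ⟨hop.refuses_iff.2 (h.refuses hP), ?_⟩
  obtain ⟨P', rfl, hs'⟩ := (hop.step_timeout_iff _ _).1 hs
  obtain ⟨ρ, hR, hρ⟩ := hop.exists_remapTrace hE
  have timeout {Q' : Expr} (hs : Step Q .timeout Q') : Step (op Q) .timeout (op Q') :=
    (hop.step_timeout_iff _ _).2 ⟨_, rfl, hs⟩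
  obtain ⟨ρ, rfl⟩ | hh := hR.head_of_inr
  · obtain ⟨-, Q', ht, hQ'⟩ := (h.rooted_iff _ _).1 ⟨hP, P', hs', hρ⟩
    exact ⟨_, timeout ht, hop.fft_of_remapTrace hQ' hR⟩
  · obtain ⟨Q', ht, hQ' | hQ'⟩ := h.exists_timeout hP hs' hh hρ
    · exact ⟨_, timeout ht, hop.fft_of_remapTrace hQ' hR⟩
    · exact ⟨_, timeout ht, hop.fft_of_remapTrace hQ' hR.merge⟩

theorem rootedEquiv {op : Expr → Expr} {L : ℕ → Option ℕ → Prop} (hop : IsRemapping op L)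
    {P Q : Expr} (h : RootedEquiv P Q) : RootedEquiv (op P) (op Q) where
  fft_iff _ := ⟨hop.fft_mono fun σ => (h.fft_iff σ).1, hop.fft_mono fun σ => (h.fft_iff σ).2⟩
  stable_iff := by
    rw [hop.stable_iff, hop.stable_iff]
    exact ⟨h.refuses, h.symm.refuses⟩
  rooted_iff _ _ := ⟨hop.rootedTrace h, hop.rootedTrace h.symm⟩

end IsRemapping

theorem isRemapping_abs (I : Set ℕ) : IsRemapping (.abs I)
    fun a l => (a ∈ I ∧ l = none) ∨ (a ∉ I ∧ l = some a) where
  step_tau_iff P E := by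
    constructor
    · rintro ⟨⟩
      · exact ⟨_, rfl, .inl ‹_›⟩
      · exact ⟨_, rfl, .inr ⟨_, .inl ⟨‹_›, rfl⟩, ‹_›⟩⟩
    · rintro ⟨P', rfl, hs | ⟨a, ⟨ha, -⟩ | ⟨-, h⟩, hs⟩⟩
      · exact .absFree hs (by simp [Act.notIn])
      · exact .absHide hs ha
      · cases h
  step_timeout_iff P E := by
    constructor
    · rintro ⟨⟩
      exact ⟨_, rfl, ‹_›⟩
    · rintro ⟨P', rfl, hs⟩
      exact .absFree hs (by simp [Act.notIn])
  step_act_iff P b E := by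
    constructor
    · rintro (_ | _ | _ | _ | _ | _ | _ | _ | _ | ⟨hs, hb⟩)
      exact ⟨_, rfl, b, hs, .inr ⟨hb b rfl, rfl⟩⟩
    · rintro ⟨P', rfl, a, hs, ⟨-, h⟩ | ⟨ha, h⟩⟩
      · cases h
      · cases h
        exact .absFree hs (by simpa [Act.notIn] using ha)

theorem isRemapping_ren (R : Set (ℕ × ℕ)) : IsRemapping (.ren R)
    fun a l => ∃ b, l = some b ∧ (a, b) ∈ R where
  step_tau_iff P E := by
    constructor
    · rintro ⟨⟩
      exact ⟨_, rfl, .inl ‹_›⟩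
    · rintro ⟨P', rfl, hs | ⟨a, ⟨b, h, -⟩, -⟩⟩
      · exact .renTau hs
      · cases h
  step_timeout_iff P E := by
    constructor
    · rintro ⟨⟩
      exact ⟨_, rfl, ‹_›⟩
    · rintro ⟨P', rfl, hs⟩
      exact .renTimeout hs
  step_act_iff P b E := by
    constructor
    · rintro ⟨⟩
      exact ⟨_, rfl, _, ‹_›, b, rfl, ‹_›⟩
    · rintro ⟨P', rfl, a, hs, _, h, hab⟩
      cases h
      exact .renAct hs hab

/-! ### Parallel composition -/

theorem step_par_tau_iff {S : Set ℕ} {P Q E : Expr} : Step (.par S P Q) .tau E ↔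
    (∃ P', E = .par S P' Q ∧ Step P .tau P') ∨ ∃ Q', E = .par S P Q' ∧ Step Q .tau Q' := by
  constructor
  · rintro ⟨⟩
    · exact .inl ⟨_, rfl, ‹_›⟩
    · exact .inr ⟨_, rfl, ‹_›⟩
  · rintro (⟨P', rfl, hs⟩ | ⟨Q', rfl, hs⟩)
    · exact .parL hs (by simp [Act.notIn])
    · exact .parR hs (by simp [Act.notIn])

theorem step_par_timeout_iff {S : Set ℕ} {P Q E : Expr} : Step (.par S P Q) .timeout E ↔
    (∃ P', E = .par S P' Q ∧ Step P .timeout P') ∨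
      ∃ Q', E = .par S P Q' ∧ Step Q .timeout Q' := by
  constructor
  · rintro ⟨⟩
    · exact .inl ⟨_, rfl, ‹_›⟩
    · exact .inr ⟨_, rfl, ‹_›⟩
  · rintro (⟨P', rfl, hs⟩ | ⟨Q', rfl, hs⟩)
    · exact .parL hs (by simp [Act.notIn])
    · exact .parR hs (by simp [Act.notIn])

theorem step_par_act_iff {S : Set ℕ} {P Q E : Expr} {a : ℕ} : Step (.par S P Q) (.act a) E ↔
    (a ∉ S ∧ ((∃ P', E = .par S P' Q ∧ Step P (.act a) P') ∨
      ∃ Q', E = .par S P Q' ∧ Step Q (.act a) Q')) ∨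
    (a ∈ S ∧ ∃ P' Q', E = .par S P' Q' ∧ Step P (.act a) P' ∧ Step Q (.act a) Q') := by
  constructor
  · intro h
    cases h with
    | parL hs ha => exact .inl ⟨ha a rfl, .inl ⟨_, rfl, hs⟩⟩
    | parR hs ha => exact .inl ⟨ha a rfl, .inr ⟨_, rfl, hs⟩⟩
    | parSync hs hs' ha => exact .inr ⟨ha, _, _, rfl, hs, hs'⟩
  · rintro (⟨ha, ⟨P', rfl, hs⟩ | ⟨Q', rfl, hs⟩⟩ | ⟨ha, P', Q', rfl, hs, hs'⟩)
    · exact .parL hs (by simpa [Act.notIn] using ha)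
    · exact .parR hs (by simpa [Act.notIn] using ha)
    · exact .parSync hs hs' ha

theorem stable_par_iff {S : Set ℕ} {P Q : Expr} :
    stable (.par S P Q) ↔ stable P ∧ stable Q := by
  constructor
  · intro h
    exact ⟨fun ⟨_, hs⟩ => h ⟨_, step_par_tau_iff.2 (.inl ⟨_, rfl, hs⟩)⟩,
      fun ⟨_, hs⟩ => h ⟨_, step_par_tau_iff.2 (.inr ⟨_, rfl, hs⟩)⟩⟩
  · rintro ⟨hP, hQ⟩ ⟨E, hs⟩
    obtain ⟨P', -, hs⟩ | ⟨Q', -, hs⟩ := step_par_tau_iff.1 hs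
    · exact hP ⟨_, hs⟩
    · exact hQ ⟨_, hs⟩

theorem mem_initials_par_iff {S : Set ℕ} {P Q : Expr} {a : ℕ} :
    a ∈ initials (.par S P Q) ↔ (a ∉ S ∧ (a ∈ initials P ∨ a ∈ initials Q)) ∨
      (a ∈ S ∧ a ∈ initials P ∧ a ∈ initials Q) := by
  constructor
  · rintro ⟨E, hs⟩
    obtain ⟨ha, ⟨P', -, hs⟩ | ⟨Q', -, hs⟩⟩ | ⟨ha, P', Q', -, hs, hs'⟩ := step_par_act_iff.1 hs
    · exact .inl ⟨ha, .inl ⟨_, hs⟩⟩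
    · exact .inl ⟨ha, .inr ⟨_, hs⟩⟩
    · exact .inr ⟨ha, ⟨_, hs⟩, ⟨_, hs'⟩⟩
  · rintro (⟨ha, ⟨P', hs⟩ | ⟨Q', hs⟩⟩ | ⟨ha, ⟨P', hs⟩, ⟨Q', hs'⟩⟩)
    · exact ⟨_, step_par_act_iff.2 (.inl ⟨ha, .inl ⟨_, rfl, hs⟩⟩)⟩
    · exact ⟨_, step_par_act_iff.2 (.inl ⟨ha, .inr ⟨_, rfl, hs⟩⟩)⟩
    · exact ⟨_, step_par_act_iff.2 (.inr ⟨ha, _, _, rfl, hs, hs'⟩)⟩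

/-- Refusals `Y` and `Z` of the components yield the refusal `X` of the parallel composition. -/
def CombineRefusals (S Y Z X : Set ℕ) : Prop :=
  ∀ a ∈ X, (a ∉ S → a ∈ Y ∧ a ∈ Z) ∧ (a ∈ S → a ∈ Y ∨ a ∈ Z)

theorem CombineRefusals.symm {S Y Z X : Set ℕ} (h : CombineRefusals S Y Z X) :
    CombineRefusals S Z Y X :=
  fun a ha => ⟨fun hS => ((h a ha).1 hS).symm, fun hS => ((h a ha).2 hS).symm⟩

theorem Refuses.par {S Y Z X : Set ℕ} {P Q : Expr} (hP : Refuses P Y) (hQ : Refuses Q Z)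
    (h : CombineRefusals S Y Z X) : Refuses (.par S P Q) X := by
  refine ⟨stable_par_iff.2 ⟨hP.1, hQ.1⟩, fun a ha hi => ?_⟩
  obtain ⟨hS, hi⟩ | ⟨hS, hi, hi'⟩ := mem_initials_par_iff.1 hi
  · have ⟨hY, hZ⟩ := (h a ha).1 hS
    exact hi.elim (hP.2 a hY) (hQ.2 a hZ)
  · exact ((h a ha).2 hS).elim (fun hY => hP.2 a hY hi) (fun hZ => hQ.2 a hZ hi')

theorem Refuses.par_comm {S X : Set ℕ} {P Q : Expr} (h : Refuses (.par S P Q) X) :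
    Refuses (.par S Q P) X := by
  refine ⟨stable_par_iff.2 (stable_par_iff.1 h.1).symm, fun a ha hi => h.2 a ha ?_⟩
  rw [mem_initials_par_iff] at hi ⊢
  tauto

/-- The actions in `X` that a process in parallel with `Q` is free to perform. -/
def offered (S X : Set ℕ) (Q : Expr) : Set ℕ := {a | a ∈ X ∧ (a ∈ S → a ∈ initials Q)}

/-- The actions in `X` that `Q` has to refuse if the process in parallel with `Q` refuses
`offered S X Q`. -/
def blocked (S X : Set ℕ) (Q : Expr) : Set ℕ := {a | a ∈ X ∧ (a ∈ S → a ∉ initials Q)}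

theorem combineRefusals_offered_blocked (S X : Set ℕ) (Q : Expr) :
    CombineRefusals S (offered S X Q) (blocked S X Q) X := by
  intro a ha
  simp only [offered, blocked, Set.mem_ofPred_eq]
  tauto

theorem Refuses.offered_left {S X : Set ℕ} {P Q : Expr} (h : Refuses (.par S P Q) X) :
    Refuses P (offered S X Q) := by
  refine ⟨(stable_par_iff.1 h.1).1, fun a ha hi => h.2 a ha.1 ?_⟩
  have := ha.2
  rw [mem_initials_par_iff]
  tauto

theorem Refuses.blocked_right {S X : Set ℕ} {P Q : Expr} (h : Refuses (.par S P Q) X) :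
    Refuses Q (blocked S X Q) := by
  refine ⟨(stable_par_iff.1 h.1).2, fun a ha hi => h.2 a ha.1 ?_⟩
  have := ha.2
  rw [mem_initials_par_iff]
  tauto

/-- `ParTrace S ρ₁ ρ₂ σ`: processes with traces `ρ₁` and `ρ₂`, put in parallel with
synchronisation on `S`, have trace `σ`. -/
inductive ParTrace (S : Set ℕ) : PFT → PFT → PFT → Prop
  | nil : ParTrace S [] [] []
  | left {a ρ₁ ρ₂ σ} : a ∉ S → ParTrace S ρ₁ ρ₂ σ →
      ParTrace S (Sum.inl a :: ρ₁) ρ₂ (Sum.inl a :: σ)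
  | right {a ρ₁ ρ₂ σ} : a ∉ S → ParTrace S ρ₁ ρ₂ σ →
      ParTrace S ρ₁ (Sum.inl a :: ρ₂) (Sum.inl a :: σ)
  | sync {a ρ₁ ρ₂ σ} : a ∈ S → ParTrace S ρ₁ ρ₂ σ →
      ParTrace S (Sum.inl a :: ρ₁) (Sum.inl a :: ρ₂) (Sum.inl a :: σ)
  | refusal {X Y Z ρ₁ ρ₂ σ} : CombineRefusals S Y Z X →
      (HeadIn Y ρ₁ ∨ HeadIn Z ρ₂ → HeadIn X σ) → ¬ (HeadIn Y ρ₁ ∧ HeadIn Z ρ₂) →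
      ParTrace S ρ₁ ρ₂ σ →
      ParTrace S (Sum.inr Y :: ρ₁) (Sum.inr Z :: ρ₂) (Sum.inr X :: σ)
  | merge {X Y Z ρ₁ ρ₂ σ} : CombineRefusals S Y Z X → ParTrace S ρ₁ ρ₂ (Sum.inr X :: σ) →
      ParTrace S (Sum.inr Y :: ρ₁) (Sum.inr Z :: ρ₂) (Sum.inr X :: σ)

namespace ParTrace

theorem symm {S : Set ℕ} {ρ₁ ρ₂ σ : PFT} (h : ParTrace S ρ₁ ρ₂ σ) : ParTrace S ρ₂ ρ₁ σ := by
  induction h with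
  | nil => exact .nil
  | left ha _ ih => exact .right ha ih
  | right ha _ ih => exact .left ha ih
  | sync ha _ ih => exact .sync ha ih
  | refusal hX h h' _ ih => exact .refusal hX.symm (fun k => h k.symm) (fun k => h' k.symm) ih
  | merge hX _ ih => exact .merge hX.symm ih

theorem not_headIn_of_inr {S X Y : Set ℕ} {ρ₁ ρ₂ σ : PFT}
    (h : ParTrace S ρ₁ ρ₂ (Sum.inr X :: σ)) : ¬ HeadIn Y ρ₁ := by
  rintro ⟨a, ρ, rfl, -⟩
  cases h

/-- Combination of two traces starting with refusal sets. -/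
theorem fft_par_inr {S X Y Z : Set ℕ} {ρ₁ ρ₂ σ : PFT} (hX : CombineRefusals S Y Z X)
    (refusal : ∀ {P Q}, Refuses (.par S P Q) X → fft P ρ₁ → fft Q ρ₂ →
      fft (.par S P Q) (Sum.inr X :: σ))
    (left : ∀ {P P' Q}, Refuses (.par S P Q) X → Step P .timeout P' → HeadIn Y ρ₁ →
      fft P' ρ₁ → fft Q ρ₂ → fft (.par S P Q) (Sum.inr X :: σ))
    (right : ∀ {P Q Q'}, Refuses (.par S P Q) X → Step Q .timeout Q' → HeadIn Z ρ₂ →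
      fft P ρ₁ → fft Q' ρ₂ → fft (.par S P Q) (Sum.inr X :: σ))
    (hnot : ¬ (HeadIn Y ρ₁ ∧ HeadIn Z ρ₂)) {P Q : Expr}
    (hP : fft P (Sum.inr Y :: ρ₁)) (hQ : fft Q (Sum.inr Z :: ρ₂)) :
    fft (.par S P Q) (Sum.inr X :: σ) := by
  have tauR {P Q Q' : Expr} (hs : Step Q .tau Q')
      (ih : fft (.par S P Q') (Sum.inr X :: σ)) : fft (.par S P Q) (Sum.inr X :: σ) :=
    .tau (step_par_tau_iff.2 (.inr ⟨_, rfl, hs⟩)) ih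
  have timeoutR {P Q Q' : Expr} (hP : Refuses P Y) (hQ : Refuses Q Z)
      (hs : Step Q .timeout Q') (ih : fft (.par S P Q') (Sum.inr X :: σ)) :
      fft (.par S P Q) (Sum.inr X :: σ) :=
    (hP.par hQ hX).fft_cons_of_timeout (step_par_timeout_iff.2 (.inr ⟨_, rfl, hs⟩)) ih
  refine fft_inr_induction (motive := fun P => ∀ Q, fft Q (Sum.inr Z :: ρ₂) →
    fft (.par S P Q) (Sum.inr X :: σ)) ?_ ?_ ?_ ?_ hP Q hQ
  · exact fun P P' hs ih Q hQ => .tau (step_par_tau_iff.2 (.inl ⟨_, rfl, hs⟩)) (ih Q hQ)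
  · intro P hP h₁ Q hQ
    refine fft_inr_induction (motive := fun Q => fft (.par S P Q) (Sum.inr X :: σ))
      ?_ ?_ ?_ ?_ hQ
    · exact fun Q Q' => tauR
    · exact fun Q hQ h₂ => refusal (hP.par hQ hX) h₁ h₂
    · exact fun Q Q' => timeoutR hP
    · exact fun Q Q' hQ hs hh h₂ => right (hP.par hQ hX) hs hh h₁ h₂
  · intro P P' hP hs ih Q hQ
    have timeoutL {Q : Expr} (hQ : Refuses Q Z) (h : fft Q (Sum.inr Z :: ρ₂)) :
        fft (.par S P Q) (Sum.inr X :: σ) :=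
      (hP.par hQ hX).fft_cons_of_timeout (step_par_timeout_iff.2 (.inl ⟨_, rfl, hs⟩)) (ih Q h)
    refine fft_inr_induction (motive := fun Q => fft (.par S P Q) (Sum.inr X :: σ))
      ?_ ?_ ?_ ?_ hQ
    · exact fun Q Q' => tauR
    · exact fun Q hQ h₂ => timeoutL hQ (hQ.fft_cons h₂)
    · exact fun Q Q' => timeoutR hP
    · exact fun Q Q' hQ hs hh h₂ => timeoutL hQ (hQ.fft_cons_of_headIn hs hh h₂)
  · intro P P' hP hs hh h₁ Q hQ
    refine fft_inr_induction (motive := fun Q => fft (.par S P Q) (Sum.inr X :: σ))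
      ?_ ?_ ?_ ?_ hQ
    · exact fun Q Q' => tauR
    · exact fun Q hQ h₂ => left (hP.par hQ hX) hs hh h₁ h₂
    · exact fun Q Q' => timeoutR hP
    · exact fun Q Q' hQ hs' hh' h₂ => (hnot ⟨hh, hh'⟩).elim

theorem fft_par {S : Set ℕ} {ρ₁ ρ₂ σ : PFT} (h : ParTrace S ρ₁ ρ₂ σ) {P Q : Expr}
    (hP : fft P ρ₁) (hQ : fft Q ρ₂) : fft (.par S P Q) σ := by
  induction h generalizing P Q with
  | nil => exact .top
  | left ha _ ih =>
    refine fft_inl_induction (motive := fun P => fft (.par S P Q) _) ?_ ?_ hP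
    · exact fun P P' hs h => .tau (step_par_tau_iff.2 (.inl ⟨_, rfl, hs⟩)) h
    · exact fun P P' hs h =>
        .act (step_par_act_iff.2 (.inl ⟨ha, .inl ⟨_, rfl, hs⟩⟩)) (ih h hQ)
  | right ha _ ih =>
    refine fft_inl_induction (motive := fun Q => fft (.par S P Q) _) ?_ ?_ hQ
    · exact fun Q Q' hs h => .tau (step_par_tau_iff.2 (.inr ⟨_, rfl, hs⟩)) h
    · exact fun Q Q' hs h =>
        .act (step_par_act_iff.2 (.inl ⟨ha, .inr ⟨_, rfl, hs⟩⟩)) (ih hP h)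
  | sync ha _ ih =>
    refine fft_inl_induction (motive := fun P => fft (.par S P Q) _) ?_ ?_ hP
    · exact fun P P' hs h => .tau (step_par_tau_iff.2 (.inl ⟨_, rfl, hs⟩)) h
    · intro P P' hs h
      refine fft_inl_induction (motive := fun Q => fft (.par S P Q) _) ?_ ?_ hQ
      · exact fun Q Q' hs h => .tau (step_par_tau_iff.2 (.inr ⟨_, rfl, hs⟩)) h
      · exact fun Q Q' hs' h' =>
          .act (step_par_act_iff.2 (.inr ⟨ha, _, _, rfl, hs, hs'⟩)) (ih h h')
  | refusal hX hh hnot _ ih =>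
    refine fft_par_inr hX ?_ ?_ ?_ hnot hP hQ
    · exact fun hr h₁ h₂ => hr.fft_cons (ih h₁ h₂)
    · exact fun hr hs h h₁ h₂ => hr.fft_cons_of_headIn
        (step_par_timeout_iff.2 (.inl ⟨_, rfl, hs⟩)) (hh (.inl h)) (ih h₁ h₂)
    · exact fun hr hs h h₁ h₂ => hr.fft_cons_of_headIn
        (step_par_timeout_iff.2 (.inr ⟨_, rfl, hs⟩)) (hh (.inr h)) (ih h₁ h₂)
  | merge hX h ih =>
    refine fft_par_inr hX ?_ ?_ ?_ (fun k => h.not_headIn_of_inr k.1) hP hQ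
    · exact fun _ h₁ h₂ => ih h₁ h₂
    · exact fun _ _ k _ _ => (h.not_headIn_of_inr k).elim
    · exact fun _ _ k _ _ => (h.symm.not_headIn_of_inr k).elim

end ParTrace

/-- The trace `σ` of `P ∥_S Q` arises from traces of `P` and `Q`.  If it starts with a refusal
set and one component is stable, the initial refusal sets of these traces can be chosen as
dictated by the initial actions of that component. -/
structure ParDecomp (S : Set ℕ) (P Q : Expr) (σ : PFT) : Prop where
  decomp : ∃ ρ₁ ρ₂, ParTrace S ρ₁ ρ₂ σ ∧ fft P ρ₁ ∧ fft Q ρ₂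
  of_stable_right : ∀ X σ', σ = Sum.inr X :: σ' → stable Q → ∃ ρ₁ ρ₂,
    ParTrace S (Sum.inr (offered S X Q) :: ρ₁) (Sum.inr (blocked S X Q) :: ρ₂) σ ∧
      fft P (Sum.inr (offered S X Q) :: ρ₁) ∧ fft Q (Sum.inr (blocked S X Q) :: ρ₂)
  of_stable_left : ∀ X σ', σ = Sum.inr X :: σ' → stable P → ∃ ρ₁ ρ₂,
    ParTrace S (Sum.inr (blocked S X P) :: ρ₁) (Sum.inr (offered S X P) :: ρ₂) σ ∧
      fft P (Sum.inr (blocked S X P) :: ρ₁) ∧ fft Q (Sum.inr (offered S X P) :: ρ₂)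

namespace ParDecomp

theorem symm {S : Set ℕ} {P Q : Expr} {σ : PFT} (h : ParDecomp S P Q σ) :
    ParDecomp S Q P σ where
  decomp :=
    have ⟨ρ₁, ρ₂, h, h₁, h₂⟩ := h.decomp
    ⟨ρ₂, ρ₁, h.symm, h₂, h₁⟩
  of_stable_right X σ' e hP :=
    have ⟨ρ₁, ρ₂, h, h₁, h₂⟩ := h.of_stable_left X σ' e hP
    ⟨ρ₂, ρ₁, h.symm, h₂, h₁⟩
  of_stable_left X σ' e hQ :=
    have ⟨ρ₁, ρ₂, h, h₁, h₂⟩ := h.of_stable_right X σ' e hQ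
    ⟨ρ₂, ρ₁, h.symm, h₂, h₁⟩

theorem of_decomp_nil_or_inl {S : Set ℕ} {P Q : Expr} {σ : PFT}
    (hσ : ∀ X σ', σ ≠ Sum.inr X :: σ')
    (h : ∃ ρ₁ ρ₂, ParTrace S ρ₁ ρ₂ σ ∧ fft P ρ₁ ∧ fft Q ρ₂) : ParDecomp S P Q σ :=
  ⟨h, fun X σ' e => (hσ X σ' e).elim, fun X σ' e => (hσ X σ' e).elim⟩

theorem of_refuses {S X : Set ℕ} {P Q : Expr} {σ ρ₁ ρ₂ : PFT} (hX : Refuses (.par S P Q) X)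
    (h : ParTrace S (Sum.inr (offered S X Q) :: ρ₁) (Sum.inr (blocked S X Q) :: ρ₂)
      (Sum.inr X :: σ))
    (h₁ : fft P (Sum.inr (offered S X Q) :: ρ₁)) (h₂ : fft Q (Sum.inr (blocked S X Q) :: ρ₂)) :
    ParDecomp S P Q (Sum.inr X :: σ) where
  decomp := ⟨_, _, h, h₁, h₂⟩
  of_stable_right := by
    rintro _ _ ⟨⟩ -
    exact ⟨_, _, h, h₁, h₂⟩
  of_stable_left := by
    rintro _ _ ⟨⟩ -
    exact ⟨_, _, .merge (combineRefusals_offered_blocked S X P).symm h,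
      hX.par_comm.blocked_right.fft_cons h₁, hX.par_comm.offered_left.fft_cons h₂⟩

theorem tau_left {S : Set ℕ} {P P' Q : Expr} {σ : PFT} (hs : Step P .tau P')
    (h : ParDecomp S P' Q σ) : ParDecomp S P Q σ where
  decomp :=
    have ⟨ρ₁, ρ₂, h, h₁, h₂⟩ := h.decomp
    ⟨ρ₁, ρ₂, h, .tau hs h₁, h₂⟩
  of_stable_right X σ' e hQ :=
    have ⟨ρ₁, ρ₂, h, h₁, h₂⟩ := h.of_stable_right X σ' e hQ
    ⟨ρ₁, ρ₂, h, .tau hs h₁, h₂⟩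
  of_stable_left _ _ _ hP := (hP ⟨_, hs⟩).elim

theorem act_left {S : Set ℕ} {P P' Q : Expr} {a : ℕ} {σ : PFT} (ha : a ∉ S)
    (hs : Step P (.act a) P') (h : ParDecomp S P' Q σ) : ParDecomp S P Q (Sum.inl a :: σ) :=
  have ⟨_, _, h, h₁, h₂⟩ := h.decomp
  of_decomp_nil_or_inl (by simp) ⟨_, _, .left ha h, .act hs h₁, h₂⟩

theorem refusal {S X : Set ℕ} {P Q : Expr} {σ : PFT} (hX : Refuses (.par S P Q) X)
    (h : ParDecomp S P Q σ) : ParDecomp S P Q (Sum.inr X :: σ) := by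
  obtain ⟨ρ₁, ρ₂, h, h₁, h₂⟩ := h.decomp
  have hP := hX.offered_left
  have hQ := hX.blocked_right
  refine of_refuses hX (.refusal (combineRefusals_offered_blocked S X Q) ?_ ?_ h)
    (hP.fft_cons h₁) (hQ.fft_cons h₂)
  · rintro (k | k)
    · exact (hP.not_headIn h₁ k).elim
    · exact (hQ.not_headIn h₂ k).elim
  · exact fun k => hP.not_headIn h₁ k.1

theorem timeoutRef_left {S X : Set ℕ} {P P' Q : Expr} {σ : PFT} (hX : Refuses (.par S P Q) X)
    (hs : Step P .timeout P') (h : ParDecomp S P' Q (Sum.inr X :: σ)) :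
    ParDecomp S P Q (Sum.inr X :: σ) :=
  have ⟨_, _, h, h₁, h₂⟩ := h.of_stable_right X σ rfl hX.blocked_right.1
  of_refuses hX h (hX.offered_left.fft_cons_of_timeout hs h₁) h₂

theorem timeoutAct_left {S X : Set ℕ} {P P' Q : Expr} {σ : PFT} (hX : Refuses (.par S P Q) X)
    (hs : Step P .timeout P') (hσ : HeadIn X σ) (h : ParDecomp S P' Q σ) :
    ParDecomp S P Q (Sum.inr X :: σ) := by
  obtain ⟨ρ₁, ρ₂, h, h₁, h₂⟩ := h.decomp
  have hQ := hX.blocked_right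
  have hh : HeadIn (offered S X Q) ρ₁ := by
    obtain ⟨a, σ, rfl, ha⟩ := hσ
    cases h with
    | left haS _ => exact ⟨_, _, rfl, ha, fun h => (haS h).elim⟩
    | right haS _ => exact (hQ.not_headIn h₂ ⟨_, _, rfl, ha, fun h => (haS h).elim⟩).elim
    | sync _ _ => exact ⟨_, _, rfl, ha, fun _ => mem_initials_of_fft hQ.1 h₂⟩
  exact of_refuses hX
    (.refusal (combineRefusals_offered_blocked S X Q) (fun _ => hσ)
      (fun k => hQ.not_headIn h₂ k.2) h)
    (hX.offered_left.fft_cons_of_headIn hs hh h₁) (hQ.fft_cons h₂)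

end ParDecomp

theorem parDecomp_of_fft {S : Set ℕ} {P Q : Expr} {σ : PFT} (hσ : fft (.par S P Q) σ) :
    ParDecomp S P Q σ := by
  refine fft_induction (motive := fun E σ => ∀ P Q, E = .par S P Q → ParDecomp S P Q σ)
    ?_ ?_ ?_ ?_ ?_ ?_ hσ P Q rfl
  · exact fun _ _ _ _ => .of_decomp_nil_or_inl (by simp) ⟨_, _, .nil, .top, .top⟩
  · rintro _ E a σ hstep - ih P Q rfl
    obtain ⟨ha, ⟨P', rfl, hs⟩ | ⟨Q', rfl, hs⟩⟩ | ⟨ha, P', Q', rfl, hs, hs'⟩ :=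
      step_par_act_iff.1 hstep
    · exact (ih _ _ rfl).act_left ha hs
    · exact ((ih _ _ rfl).symm.act_left ha hs).symm
    · obtain ⟨ρ₁, ρ₂, h, h₁, h₂⟩ := (ih _ _ rfl).decomp
      exact .of_decomp_nil_or_inl (by simp) ⟨_, _, .sync ha h, .act hs h₁, .act hs' h₂⟩
  · rintro _ E σ hstep - ih P Q rfl
    obtain ⟨P', rfl, hs⟩ | ⟨Q', rfl, hs⟩ := step_par_tau_iff.1 hstep
    · exact (ih _ _ rfl).tau_left hs
    · exact ((ih _ _ rfl).symm.tau_left hs).symm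
  · rintro _ X σ hX - ih P Q rfl
    exact (ih _ _ rfl).refusal hX
  · rintro _ E X σ hX hstep - ih P Q rfl
    obtain ⟨P', rfl, hs⟩ | ⟨Q', rfl, hs⟩ := step_par_timeout_iff.1 hstep
    · exact (ih _ _ rfl).timeoutRef_left hX hs
    · exact ((ih _ _ rfl).symm.timeoutRef_left hX.par_comm hs).symm
  · rintro _ E X σ hX hstep hh - ih P Q rfl
    obtain ⟨P', rfl, hs⟩ | ⟨Q', rfl, hs⟩ := step_par_timeout_iff.1 hstep
    · exact (ih _ _ rfl).timeoutAct_left hX hs hh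
    · exact ((ih _ _ rfl).symm.timeoutAct_left hX.par_comm hs hh).symm

theorem fft_par_mono {S : Set ℕ} {P P' Q Q' : Expr} (hP : ∀ σ, fft P σ → fft P' σ)
    (hQ : ∀ σ, fft Q σ → fft Q' σ) {σ : PFT} (hσ : fft (.par S P Q) σ) :
    fft (.par S P' Q') σ :=
  have ⟨_, _, h, h₁, h₂⟩ := (parDecomp_of_fft hσ).decomp
  h.fft_par (hP _ h₁) (hQ _ h₂)

namespace RootedEquiv

theorem refuses_par {S X : Set ℕ} {P P' Q Q' : Expr} (hP : RootedEquiv P P')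
    (hQ : RootedEquiv Q Q') (h : Refuses (.par S P Q) X) : Refuses (.par S P' Q') X := by
  obtain ⟨h₁, h₂⟩ := stable_par_iff.1 h.1
  refine ⟨stable_par_iff.2 ⟨hP.stable_iff.1 h₁, hQ.stable_iff.1 h₂⟩, fun a ha hi => h.2 a ha ?_⟩
  rwa [mem_initials_par_iff, hP.initials_eq h₁, hQ.initials_eq h₂, ← mem_initials_par_iff]

theorem rootedTrace_par {S X : Set ℕ} {P P' Q Q' : Expr} {σ : PFT} (hP : RootedEquiv P P')
    (hQ : RootedEquiv Q Q') (h : RootedTrace (.par S P Q) X σ) :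
    RootedTrace (.par S P' Q') X σ := by
  obtain ⟨hX, E, hstep, hE⟩ := h
  refine ⟨hP.refuses_par hQ hX, ?_⟩
  obtain ⟨P₁, rfl, hs⟩ | ⟨Q₁, rfl, hs⟩ := step_par_timeout_iff.1 hstep
  · obtain ⟨ρ₁, ρ₂, h, h₁, h₂⟩ :=
      (parDecomp_of_fft hE).of_stable_right X σ rfl hX.blocked_right.1
    obtain ⟨-, P₂, hs', h₁'⟩ := (hP.rooted_iff _ _).1 ⟨hX.offered_left, P₁, hs, h₁⟩
    exact ⟨_, step_par_timeout_iff.2 (.inl ⟨_, rfl, hs'⟩),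
      h.fft_par h₁' ((hQ.fft_iff _).1 h₂)⟩
  · obtain ⟨ρ₁, ρ₂, h, h₁, h₂⟩ :=
      (parDecomp_of_fft hE).of_stable_left X σ rfl hX.offered_left.1
    obtain ⟨-, Q₂, hs', h₂'⟩ := (hQ.rooted_iff _ _).1 ⟨hX.par_comm.offered_left, Q₁, hs, h₂⟩
    exact ⟨_, step_par_timeout_iff.2 (.inr ⟨_, rfl, hs'⟩),
      h.fft_par ((hP.fft_iff _).1 h₁) h₂'⟩

theorem par {P P' Q Q' : Expr} (hP : RootedEquiv P P') (hQ : RootedEquiv Q Q') (S : Set ℕ) :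
    RootedEquiv (.par S P Q) (.par S P' Q') where
  fft_iff _ := ⟨fft_par_mono (fun σ => (hP.fft_iff σ).1) (fun σ => (hQ.fft_iff σ).1),
    fft_par_mono (fun σ => (hP.fft_iff σ).2) (fun σ => (hQ.fft_iff σ).2)⟩
  stable_iff := by rw [stable_par_iff, stable_par_iff, hP.stable_iff, hQ.stable_iff]
  rooted_iff _ _ := ⟨hP.rootedTrace_par hQ, hP.symm.rootedTrace_par hQ.symm⟩

end RootedEquiv

/-- Rooted partial failure trace equivalence is a congruence for
the operators of CCSP_t. -/
theorem rfft_congruence (P P' Q Q' : Expr)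
    (hP : IsProcess P) (hP' : IsProcess P') (hQ : IsProcess Q) (hQ' : IsProcess Q')
    (h1 : rfftSet P = rfftSet P') (h2 : rfftSet Q = rfftSet Q') :
    (∀ α : Act, rfftSet (.pre α P) = rfftSet (.pre α P')) ∧
    rfftSet (.choice P Q) = rfftSet (.choice P' Q') ∧
    (∀ S : Set ℕ, rfftSet (.par S P Q) = rfftSet (.par S P' Q')) ∧
    (∀ I : Set ℕ, rfftSet (.abs I P) = rfftSet (.abs I P')) ∧
    (∀ R : Set (ℕ × ℕ), (∀ a : ℕ, {b | (a, b) ∈ R}.Finite) →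
        rfftSet (.ren R P) = rfftSet (.ren R P')) := by
  rw [rfftSet_eq_iff] at h1 h2
  simp only [rfftSet_eq_iff]
  exact ⟨h1.pre, h1.choice h2, h1.par h2, fun I => (isRemapping_abs I).rootedEquiv h1,
    fun R _ => (isRemapping_ren R).rootedEquiv h1⟩
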